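/- Let G=(V,E) be a d-manifold and let ψ:V→ℂ and c∈ℂ be such that Re(ψ−c) and Im(ψ−c) are nowhere zero on V. Then the level set {ψ=c} is either the empty graph or a (d−2)-manifold. -/

import Mathlib

open scoped Classical

/-- A finite simple graph: a finite vertex set together with a symmetric, irreflexive
adjacency relation supported on the vertex set. -/
structure FGraph (V : Type) where
  verts : Finset V
  Adj : V → V → Prop
  symm : ∀ {a b}, Adj a b → Adj b a
  loopless : ∀ a, ¬ Adj a a
  mem_of_adj : ∀ {a b}, Adj a b → a ∈ verts

namespace FGraph

variable {V W : Type}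

/-- The subgraph induced on the vertices satisfying `P`. -/
noncomputable def induce (G : FGraph V) (P : V → Prop) : FGraph V where
  verts := G.verts.filter P
  Adj a b := G.Adj a b ∧ P a ∧ P b
  symm h := ⟨G.symm h.1, h.2.2, h.2.1⟩
  loopless a h := G.loopless a h.1
  mem_of_adj h := Finset.mem_filter.mpr ⟨G.mem_of_adj h.1, h.2.1⟩

/-- The unit sphere of a vertex: the subgraph induced on its neighbors. -/
noncomputable def unitSphere (G : FGraph V) (v : V) : FGraph V :=
  G.induce (fun w => G.Adj v w)

/-- The graph with the vertex `v` (and its edges) removed. -/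
noncomputable def erase (G : FGraph V) (v : V) : FGraph V :=
  G.induce (fun w => w ≠ v)

/-- Inductive definition of contractibility: the one-point graph is contractible, and a
graph is contractible if some vertex has a contractible unit sphere and contractible
complement. -/
inductive Contractible : FGraph V → Prop
  | single (G : FGraph V) (v : V) (h : G.verts = {v}) : Contractible G
  | step (G : FGraph V) (v : V) (hv : v ∈ G.verts)
      (h1 : Contractible (G.unitSphere v)) (h2 : Contractible (G.erase v)) :
      Contractible G

mutual
  /-- `G` is a `d`-sphere: the empty graph is the `(-1)`-sphere, and a `d`-manifold is a
  `d`-sphere if removing some vertex renders it contractible. -/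
  inductive IsSphere : ℤ → FGraph V → Prop
    | empty (G : FGraph V) (h : G.verts = ∅) : IsSphere (-1) G
    | punctured (d : ℤ) (G : FGraph V) (hm : IsManifold d G) (v : V) (hv : v ∈ G.verts)
        (hc : Contractible (G.erase v)) : IsSphere d G
  /-- For `d ≥ 0`, `G` is a `d`-manifold iff every unit sphere is a `(d-1)`-sphere. -/
  inductive IsManifold : ℤ → FGraph V → Prop
    | intro (d : ℤ) (hd : 0 ≤ d) (G : FGraph V)
        (h : ∀ v ∈ G.verts, IsSphere (d - 1) (G.unitSphere v)) : IsManifold d G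
end

/-- A simplex of `G`: the vertex set of a complete subgraph. -/
def IsSimplex (G : FGraph V) (x : Finset V) : Prop :=
  x.Nonempty ∧ ↑x ⊆ G.verts ∧ ∀ a ∈ x, ∀ b ∈ x, a ≠ b → G.Adj a b

/-- The Barycentric refinement: vertices are the simplices of `G`, two being adjacent iff
one is strictly contained in the other. -/
noncomputable def barycentric (G : FGraph V) : FGraph (Finset V) where
  verts := G.verts.powerset.filter (fun x => G.IsSimplex x)
  Adj x y := G.IsSimplex x ∧ G.IsSimplex y ∧ (x ⊂ y ∨ y ⊂ x)
  symm h := ⟨h.2.1, h.1, h.2.2.symm⟩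
  loopless x h := by rcases h.2.2 with h' | h' <;> exact (ssubset_irrefl x h')
  mem_of_adj h := Finset.mem_filter.mpr ⟨Finset.mem_powerset.mpr h.1.2.1, h.1⟩

/-- Number of simplices of `G` with exactly `j` vertices (so `numSimplices G (k+1)` is
the `f`-vector entry `f_k(G)`). -/
noncomputable def numSimplices (G : FGraph V) (j : ℕ) : ℕ :=
  (G.verts.powerset.filter (fun x => G.IsSimplex x ∧ x.card = j)).card

/-- Euler characteristic `χ(G) = Σ_{k ≥ 0} (-1)^k f_k(G)`, where `f_k` counts the
simplices with `k+1` vertices. -/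
noncomputable def euler (G : FGraph V) : ℤ :=
  ∑ k ∈ Finset.range G.verts.card, (-1 : ℤ) ^ k * G.numSimplices (k + 1)

/-- The level set `{f = c}`: the subgraph of the Barycentric refinement induced by the
simplices on which `f - c` changes sign. -/
noncomputable def levelSet (G : FGraph V) (f : V → ℝ) (c : ℝ) : FGraph (Finset V) :=
  G.barycentric.induce (fun x => (∃ a ∈ x, f a - c < 0) ∧ (∃ b ∈ x, 0 < f b - c))

/-- Graph isomorphism. -/
def Iso (G : FGraph V) (H : FGraph W) : Prop :=
  ∃ φ : V → W, Set.BijOn φ ↑G.verts ↑H.verts ∧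
    ∀ a ∈ G.verts, ∀ b ∈ G.verts, (G.Adj a b ↔ H.Adj (φ a) (φ b))

/-- Zykov join of two graphs: disjoint union plus all edges between the two parts. -/
noncomputable def join (G : FGraph V) (H : FGraph W) : FGraph (V ⊕ W) where
  verts := G.verts.disjSum H.verts
  Adj a b :=
    match a, b with
    | .inl a, .inl b => G.Adj a b
    | .inr a, .inr b => H.Adj a b
    | .inl a, .inr b => a ∈ G.verts ∧ b ∈ H.verts
    | .inr a, .inl b => b ∈ G.verts ∧ a ∈ H.verts
  symm {a b} h := by
    cases a <;> cases b <;> simp_all <;> first | exact G.symm h | exact H.symm h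
  loopless a h := by
    cases a <;> simp_all <;> first | exact G.loopless _ h | exact H.loopless _ h
  mem_of_adj {a b} h := by
    cases a <;> cases b <;> simp_all [Finset.mem_disjSum] <;>
      first | exact G.mem_of_adj h | exact H.mem_of_adj h

/-- Union of two graphs on the same vertex type. -/
noncomputable def union (G H : FGraph V) : FGraph V where
  verts := G.verts ∪ H.verts
  Adj a b := G.Adj a b ∨ H.Adj a b
  symm h := h.imp G.symm H.symm
  loopless a h := h.elim (G.loopless a) (H.loopless a)
  mem_of_adj h :=
    h.elim (fun h' => Finset.mem_union_left _ (G.mem_of_adj h'))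
      (fun h' => Finset.mem_union_right _ (H.mem_of_adj h'))

/-- A `d`-ball: a graph of the form `S - v` for a `d`-sphere `S` and a vertex `v` of `S`
(up to graph isomorphism). -/
def IsBall (d : ℤ) (H : FGraph W) : Prop :=
  ∃ (S : FGraph ℕ) (v : ℕ), IsSphere d S ∧ v ∈ S.verts ∧ Iso H (S.erase v)

/-- A `d`-manifold with boundary: every unit sphere is a `(d-1)`-sphere or a `(d-1)`-ball. -/
def IsManifoldWithBoundary (d : ℤ) (G : FGraph V) : Prop :=
  ∀ v ∈ G.verts, IsSphere (d - 1) (G.unitSphere v) ∨ IsBall (d - 1) (G.unitSphere v)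

/-- The cyclic graph `C_n` on the vertex set `Fin n`. -/
def cycleGraph (n : ℕ) : FGraph (Fin n) where
  verts := Finset.univ
  Adj a b := a ≠ b ∧ ((a.val + 1) % n = b.val ∨ (b.val + 1) % n = a.val)
  symm h := ⟨h.1.symm, h.2.symm⟩
  loopless a h := h.1 rfl
  mem_of_adj _ := Finset.mem_univ _

/-- `G` is a disjoint union of cyclic graphs `C_n` with `n ≥ 4`: the vertex set splits
into pairwise disjoint pieces, edges never cross between pieces, and each piece induces
a graph isomorphic to a `C_n` with `n ≥ 4`. -/
def IsDisjointUnionOfCycles (G : FGraph V) : Prop :=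
  ∃ P : Finset (Finset V),
    (∀ S ∈ P, ↑S ⊆ G.verts) ∧
    (∀ S ∈ P, ∀ T ∈ P, S ≠ T → Disjoint S T) ∧
    (∀ v ∈ G.verts, ∃ S ∈ P, v ∈ S) ∧
    (∀ a b, G.Adj a b → ∀ S ∈ P, a ∈ S → b ∈ S) ∧
    (∀ S ∈ P, ∃ n, 4 ≤ n ∧ Iso (G.induce (· ∈ S)) (cycleGraph n))

/-- Poincaré–Hopf index `i_f(v) = 1 - χ(S^-_f(v))`. -/
noncomputable def pindex (G : FGraph V) (f : V → ℝ) (v : V) : ℤ :=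
  1 - ((G.unitSphere v).induce (fun w => f w < f v)).euler

/-- Curvature `K(v) = Σ_{k ≥ 0} (-1)^k f_{k-1}(S(v))/(k+1)` with `f_{-1} = 1`. -/
noncomputable def curvature (G : FGraph V) (v : V) : ℝ :=
  ∑ k ∈ Finset.range (G.verts.card + 1),
    (-1 : ℝ) ^ k * (if k = 0 then 1 else ((G.unitSphere v).numSimplices k : ℝ)) / (k + 1)

end FGraph

/-- `sign(a + i b) = sign(a) + i sign(b)`. -/
noncomputable def csgn (z : ℂ) : ℂ :=
  ⟨Real.sign z.re, Real.sign z.im⟩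

/-- The set `U = {1+i, 1-i, -1+i, -1-i}` of possible values of `csgn`. -/
noncomputable def signU : Finset ℂ :=
  {1 + Complex.I, 1 - Complex.I, -1 + Complex.I, -1 - Complex.I}

namespace FGraph

variable {V : Type}

/-- The set of values of `sign(ψ - c)` attained on the finite vertex set `x`. -/
noncomputable def signValues (ψ : V → ℂ) (c : ℂ) (x : Finset V) : Finset ℂ :=
  x.image (fun v => csgn (ψ v - c))

/-- The level set `{ψ = c}` of a complex-valued function: the subgraph of the Barycentric
refinement induced by the simplices on which `sign(ψ - c)` takes at least three distinct
values, including `-1+i` and `1-i`. -/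
noncomputable def complexLevelSet (G : FGraph V) (ψ : V → ℂ) (c : ℂ) : FGraph (Finset V) :=
  G.barycentric.induce (fun x =>
    3 ≤ (signValues ψ c x).card ∧
    (-1 + Complex.I) ∈ signValues ψ c x ∧ (1 - Complex.I) ∈ signValues ψ c x)

/-- The level set `{ψ = 0}_e` for a two-element subset `e ⊆ U`: the subgraph of the
Barycentric refinement induced by the simplices on which `sign(ψ)` attains both values
of `e` and at least three distinct values in total. -/
noncomputable def complexLevelSetE (G : FGraph V) (ψ : V → ℂ) (e : Finset ℂ) :
    FGraph (Finset V) :=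
  G.barycentric.induce (fun x =>
    (∀ u ∈ e, u ∈ signValues ψ 0 x) ∧ 3 ≤ (signValues ψ 0 x).card)

/-- `Ψ^{-1}(t)`: the subgraph of the Barycentric refinement induced by the simplices on
which `sign(ψ)` attains all values of `t`. -/
noncomputable def signPreimage (G : FGraph V) (ψ : V → ℂ) (t : Finset ℂ) :
    FGraph (Finset V) :=
  G.barycentric.induce (fun x => ∀ u ∈ t, u ∈ signValues ψ 0 x)

/-- The sign vectors of `F - c` attained on the finite vertex set `x`. -/
noncomputable def vecSignValues {k : ℕ} (F : V → Fin k → ℝ) (c : Fin k → ℝ)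
    (x : Finset V) : Finset (Fin k → ℝ) :=
  x.image (fun v j => Real.sign (F v j - c j))

/-- The level set `{F = c}` of an `ℝ^k`-valued function: the subgraph of the Barycentric
refinement induced by the simplices on which the sign vector of `F - c` takes at least
`k+1` distinct values, including the `k` vectors `(1,…,1,-1,1,…,1)`. -/
noncomputable def vecLevelSet (G : FGraph V) {k : ℕ} (F : V → Fin k → ℝ) (c : Fin k → ℝ) :
    FGraph (Finset V) :=
  G.barycentric.induce (fun x =>
    k + 1 ≤ (vecSignValues F c x).card ∧
    ∀ j : Fin k, (fun i => if i = j then (-1 : ℝ) else 1) ∈ vecSignValues F c x)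

end FGraph

/-- The complete graph on `Fin n`. -/
def completeFGraph (n : ℕ) : FGraph (Fin n) where
  verts := Finset.univ
  Adj a b := a ≠ b
  symm h := h.symm
  loopless a h := h rfl
  mem_of_adj _ := Finset.mem_univ _

/-- Stirling numbers of the second kind. -/
def stirling2 : ℕ → ℕ → ℕ
  | 0, 0 => 1
  | 0, _ + 1 => 0
  | _ + 1, 0 => 0
  | n + 1, m + 1 => (m + 1) * stirling2 n (m + 1) + stirling2 n m

/-- Contractibility of the graph with vertex set `s` and adjacency `r`. -/
inductive RelContractible {α : Type} (r : α → α → Prop) : Set α → Prop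
  | single (v : α) : RelContractible r {v}
  | step (s : Set α) (v : α) (hv : v ∈ s) (h1 : RelContractible r {w ∈ s | r v w})
      (h2 : RelContractible r (s \ {v})) : RelContractible r s

/-- The graph with vertex set `s` and adjacency `r` is an `(n-1)`-sphere. -/
def RelSphere {α : Type} (r : α → α → Prop) : ℕ → Set α → Prop
  | 0, s => s = ∅
  | n + 1, s => (∀ v ∈ s, RelSphere r n {w ∈ s | r v w}) ∧
      ∃ v ∈ s, RelContractible r (s \ {v})

section Rel

variable {α β : Type} {r : α → α → Prop} {r' : β → β → Prop}

theorem RelContractible.of_apex (hi : ∀ a, ¬ r a a) {v : α} {s : Set α} (hs : s.Finite)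
    (hv : v ∈ s) (h : ∀ w ∈ s, w = v ∨ r w v) : RelContractible r s := by
  induction hn : s.ncard using Nat.strong_induction_on generalizing s with
  | _ n ih =>
    by_cases hsv : s = {v}
    · exact hsv ▸ .single v
    obtain ⟨w, hw, hwv⟩ : ∃ w ∈ s, w ≠ v := by
      by_contra! hc
      exact hsv (Set.eq_singleton_iff_unique_mem.2 ⟨hv, hc⟩)
    have key : ∀ t ⊆ s \ {w}, v ∈ t → RelContractible r t := fun t ht hvt =>
      ih t.ncard (hn ▸ Set.ncard_lt_ncard
        ⟨ht.trans Set.sdiff_subset, fun hc => (ht (hc hw)).2 rfl⟩ hs)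
        (hs.subset (ht.trans Set.sdiff_subset)) hvt (fun u hu => h u (ht hu).1) rfl
    refine .step s w hw (key _ ?_ ⟨hv, (h w hw).resolve_left hwv⟩)
      (key _ subset_rfl ⟨hv, fun e => hwv e.symm⟩)
    rintro u ⟨hu, hwu⟩
    exact ⟨hu, fun e => hi w (e ▸ hwu)⟩

/-- If the vertices outside `t` can be removed one by one, each with a unit sphere that is a cone
over a vertex of `t`, then contractibility of `t` gives contractibility of `s`. -/
theorem RelContractible.of_removal (hi : ∀ a, ¬ r a a) {s t : Set α} (hs : s.Finite) (hts : t ⊆ s)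
    (h : ∀ u, t ⊆ u → u ⊆ s → u ≠ t →
      ∃ z ∈ u \ t, ∃ p ∈ t, r z p ∧ ∀ w ∈ u, r z w → w = p ∨ r w p)
    (ht : RelContractible r t) : RelContractible r s := by
  induction hn : s.ncard using Nat.strong_induction_on generalizing s with
  | _ n ih =>
    by_cases hst : s = t
    · exact hst ▸ ht
    obtain ⟨z, ⟨hzs, hzt⟩, p, hp, hzp, hw⟩ := h s hts subset_rfl hst
    refine .step s z hzs (.of_apex hi (hs.subset (Set.sep_subset _ _)) ⟨hts hp, hzp⟩
      fun w hws => hw w hws.1 hws.2) ?_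
    exact ih _ (hn ▸ Set.ncard_sdiff_singleton_lt_of_mem hzs hs) (hs.subset Set.sdiff_subset)
      (fun a ha => ⟨hts ha, fun e => hzt (e ▸ ha)⟩)
      (fun u h1 h2 => h u h1 (h2.trans Set.sdiff_subset)) rfl

theorem RelContractible.image {f : α → β} {s : Set α} (h : RelContractible r s)
    (hf : Set.InjOn f s) (hr : ∀ a ∈ s, ∀ b ∈ s, r a b ↔ r' (f a) (f b)) :
    RelContractible r' (f '' s) := by
  induction h with
  | single v => rw [Set.image_singleton]; exact .single _
  | step s v hv h1 h2 ih1 ih2 =>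
    refine .step _ (f v) ⟨v, hv, rfl⟩ ?_ ?_
    · convert ih1 (hf.mono (Set.sep_subset _ _)) (fun a ha b hb => hr a ha.1 b hb.1) using 1
      ext y
      constructor
      · rintro ⟨⟨w, hw, rfl⟩, h⟩
        exact ⟨w, ⟨hw, (hr v hv w hw).2 h⟩, rfl⟩
      · rintro ⟨w, ⟨hw, h⟩, rfl⟩
        exact ⟨⟨w, hw, rfl⟩, (hr v hv w hw).1 h⟩
    · convert ih2 (hf.mono Set.sdiff_subset) (fun a ha b hb => hr a ha.1 b hb.1) using 1
      rw [hf.image_sdiff_subset (Set.singleton_subset_iff.2 hv), Set.image_singleton]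

theorem RelSphere.image {f : α → β} {n : ℕ} {s : Set α} (h : RelSphere r n s)
    (hf : Set.InjOn f s) (hr : ∀ a ∈ s, ∀ b ∈ s, r a b ↔ r' (f a) (f b)) :
    RelSphere r' n (f '' s) := by
  induction n generalizing s with
  | zero => simp only [RelSphere] at h ⊢; simp [h]
  | succ n ih =>
    obtain ⟨h1, v, hv, h2⟩ := h
    refine ⟨?_, f v, ⟨v, hv, rfl⟩, ?_⟩
    · rintro _ ⟨w, hw, rfl⟩
      convert ih (h1 w hw) (hf.mono (Set.sep_subset _ _))
        (fun a ha b hb => hr a ha.1 b hb.1) using 1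
      ext y
      constructor
      · rintro ⟨⟨u, hu, rfl⟩, h⟩
        exact ⟨u, ⟨hu, (hr w hw u hu).2 h⟩, rfl⟩
      · rintro ⟨u, ⟨hu, h⟩, rfl⟩
        exact ⟨⟨u, hu, rfl⟩, (hr w hw u hu).1 h⟩
    · convert h2.image (hf.mono Set.sdiff_subset) (fun a ha b hb => hr a ha.1 b hb.1) using 1
      rw [hf.image_sdiff_subset (Set.singleton_subset_iff.2 hv), Set.image_singleton]

theorem RelContractible.union (hi : ∀ a, ¬ r a a) {s t : Set α} (h : RelContractible r s)
    (ht : t.Finite) (hst : ∀ a ∈ s, ∀ b ∈ t, r a b ∧ r b a) : RelContractible r (s ∪ t) := by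
  induction h with
  | single v =>
    refine .of_apex hi ((Set.finite_singleton v).union ht) (.inl rfl) ?_
    rintro w (hw | hw)
    · exact .inl hw
    · exact .inr (hst v rfl w hw).2
  | step s v hv h1 h2 ih1 ih2 =>
    refine .step _ v (.inl hv) ?_ ?_
    · convert ih1 (fun _ ha => hst _ ha.1) using 1
      ext w
      have := hst v hv w
      simp only [Set.mem_ofPred_eq, Set.mem_union]
      tauto
    · convert ih2 (fun _ ha => hst _ ha.1) using 1
      have : v ∉ t := fun hvt => hi v (hst v hv v hvt).1
      rw [Set.union_sdiff_distrib, Set.sdiff_singleton_eq_self this]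

theorem RelSphere.union (hi : ∀ a, ¬ r a a) {s t : Set α} {m n : ℕ} (h : RelSphere r m s)
    (h' : RelSphere r n t) (hs : s.Finite) (ht : t.Finite)
    (hst : ∀ a ∈ s, ∀ b ∈ t, r a b ∧ r b a) : RelSphere r (m + n) (s ∪ t) := by
  induction hk : m + n generalizing m n s t with
  | zero =>
    obtain ⟨rfl, rfl⟩ : m = 0 ∧ n = 0 := by omega
    simp only [RelSphere] at h h' ⊢
    simp [h, h']
  | succ k ih =>
    refine ⟨?_, ?_⟩
    · rintro v (hv | hv)
      · obtain _ | m := m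
        · simp only [RelSphere] at h
          simp [h] at hv
        convert ih (h.1 v hv) h' (hs.subset (Set.sep_subset _ _)) ht
          (fun _ ha => hst _ ha.1) (by omega) using 1
        ext w
        have := hst v hv w
        simp only [Set.mem_ofPred_eq, Set.mem_union]
        tauto
      · obtain _ | n := n
        · simp only [RelSphere] at h'
          simp [h'] at hv
        convert ih h (h'.1 v hv) hs (ht.subset (Set.sep_subset _ _))
          (fun a ha b hb => hst a ha b hb.1) (by omega) using 1
        ext w
        have := fun hw => hst w hw v hv
        simp only [Set.mem_ofPred_eq, Set.mem_union]
        tauto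
    · obtain _ | m := m
      · obtain _ | n := n
        · omega
        simp only [RelSphere] at h
        subst h
        simpa using h'.2
      · obtain ⟨v, hv, hc⟩ := h.2
        refine ⟨v, .inl hv, ?_⟩
        have hvt : v ∉ t := fun hvt => hi v (hst v hv v hvt).1
        rw [Set.union_sdiff_distrib, Set.sdiff_singleton_eq_self hvt]
        exact hc.union hi ht (fun _ ha => hst _ ha.1)

/-- The link of a clique in a sphere is a sphere. -/
theorem RelSphere.link {n : ℕ} {s : Set α} (h : RelSphere r n s) (x : Finset α)
    (hx : ↑x ⊆ s) (hc : ∀ a ∈ x, ∀ b ∈ x, a ≠ b → r a b) :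
    ∃ m, m + x.card = n ∧ RelSphere r m {w ∈ s | ∀ a ∈ x, r a w} := by
  induction x using Finset.induction_on generalizing n s with
  | empty => exact ⟨n, by simp, by simpa using h⟩
  | insert v x hv ih =>
    have hvs : v ∈ s := hx (by simp)
    obtain _ | n := n
    · simp only [RelSphere] at h
      simp [h] at hvs
    obtain ⟨m, hm, hl⟩ := ih (h.1 v hvs)
      (fun a ha => ⟨hx (by simp_all), hc v (by simp) a (Finset.mem_insert_of_mem ha)
        (by rintro rfl; exact hv ha)⟩)
      (fun a ha b hb => hc a (Finset.mem_insert_of_mem ha) b (Finset.mem_insert_of_mem hb))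
    refine ⟨m, by rw [Finset.card_insert_of_notMem hv]; omega, ?_⟩
    convert hl using 1
    ext w
    simp [and_assoc]

end Rel

section Inclusion

variable {V : Type}

/-- Comparability under strict inclusion. -/
def StrictComparable (x y : Finset V) : Prop := x ⊂ y ∨ y ⊂ x

theorem not_strictComparable_self (x : Finset V) : ¬ StrictComparable x x := by
  simp [StrictComparable]

theorem RelContractible.of_up {s t : Set (Finset V)} (hs : s.Finite) (hts : t ⊆ s)
    (h : ∀ z ∈ s, z ∉ t → ∃ p ∈ t, z ⊂ p ∧ ∀ w ∈ t, z ⊂ w → p ⊆ w)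
    (ht : RelContractible StrictComparable t) : RelContractible StrictComparable s := by
  refine ht.of_removal not_strictComparable_self hs hts fun u h1 h2 h3 => ?_
  obtain ⟨z, hz⟩ := (hs.subset (Set.sdiff_subset.trans h2) : (u \ t).Finite).exists_maximal
    (Set.sdiff_nonempty.2 fun hc => h3 (hc.antisymm h1))
  obtain ⟨p, hp, hzp, hw⟩ := h z (h2 hz.prop.1) hz.prop.2
  refine ⟨z, hz.prop, p, hp, .inl hzp, fun w hwu hzw => ?_⟩
  rcases hzw with hzw | hzw
  · have hwt : w ∈ t := by
      by_contra hwt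
      exact hz.not_gt ⟨hwu, hwt⟩ hzw
    rcases (hw w hwt hzw).eq_or_ssubset with e | e
    · exact .inl e.symm
    · exact .inr (.inr e)
  · exact .inr (.inl (hzw.trans hzp))

theorem RelContractible.of_down {s t : Set (Finset V)} (hs : s.Finite) (hts : t ⊆ s)
    (h : ∀ z ∈ s, z ∉ t → ∃ p ∈ t, p ⊂ z ∧ ∀ w ∈ t, w ⊂ z → w ⊆ p)
    (ht : RelContractible StrictComparable t) : RelContractible StrictComparable s := by
  refine ht.of_removal not_strictComparable_self hs hts fun u h1 h2 h3 => ?_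
  obtain ⟨z, hz⟩ := (hs.subset (Set.sdiff_subset.trans h2) : (u \ t).Finite).exists_minimal
    (Set.sdiff_nonempty.2 fun hc => h3 (hc.antisymm h1))
  obtain ⟨p, hp, hzp, hw⟩ := h z (h2 hz.prop.1) hz.prop.2
  refine ⟨z, hz.prop, p, hp, .inr hzp, fun w hwu hzw => ?_⟩
  rcases hzw with hzw | hzw
  · exact .inr (.inr (hzp.trans hzw))
  · have hwt : w ∈ t := by
      by_contra hwt
      exact hz.not_lt ⟨hwu, hwt⟩ hzw
    rcases (hw w hwt hzw).eq_or_ssubset with e | e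
    · exact .inl e
    · exact .inr (.inl e)

/-- If the elements of `s` below and above `y` form spheres, so do all elements comparable
with `y`. -/
theorem RelSphere.of_below_above {s : Set (Finset V)} {y : Finset V} {m n : ℕ} (hs : s.Finite)
    (h : RelSphere StrictComparable m {w ∈ s | w ⊂ y})
    (h' : RelSphere StrictComparable n {w ∈ s | y ⊂ w}) :
    RelSphere StrictComparable (m + n) {w ∈ s | StrictComparable y w} := by
  convert h.union not_strictComparable_self h' (hs.subset (Set.sep_subset _ _))
    (hs.subset (Set.sep_subset _ _))
    (fun a ha b hb => ⟨.inl (ha.2.trans hb.2), .inr (ha.2.trans hb.2)⟩) using 1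
  ext w
  simp only [StrictComparable, Set.mem_ofPred_eq, Set.mem_union]
  tauto

theorem strictComparable_union_iff {y : Finset V} {s : Set (Finset V)}
    (hd : ∀ w ∈ s, Disjoint w y) :
    ∀ a ∈ s, ∀ b ∈ s, StrictComparable a b ↔ StrictComparable (a ∪ y) (b ∪ y) := by
  have key : ∀ a ∈ s, ∀ b, a ∪ y ⊆ b ∪ y ↔ a ⊆ b := fun a ha b =>
    ⟨fun h => (hd a ha).left_le_of_le_sup_right (Finset.subset_union_left.trans h),
      fun h => Finset.union_subset_union_left h⟩
  intro a ha b hb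
  simp only [StrictComparable, ssubset_iff_subset_not_subset, key a ha b, key b hb a]

theorem injOn_union_right {y : Finset V} {s : Set (Finset V)} (hd : ∀ w ∈ s, Disjoint w y) :
    Set.InjOn (· ∪ y) s := fun a ha b hb h =>
  Finset.Subset.antisymm
    ((hd a ha).left_le_of_le_sup_right (Finset.subset_union_left.trans h.subset))
    ((hd b hb).left_le_of_le_sup_right (Finset.subset_union_left.trans h.symm.subset))

theorem RelContractible.image_union {y : Finset V} {s : Set (Finset V)}
    (h : RelContractible StrictComparable s) (hd : ∀ w ∈ s, Disjoint w y) :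
    RelContractible StrictComparable ((· ∪ y) '' s) :=
  h.image (injOn_union_right hd) (strictComparable_union_iff hd)

theorem RelSphere.image_union {y : Finset V} {s : Set (Finset V)} {n : ℕ}
    (h : RelSphere StrictComparable n s) (hd : ∀ w ∈ s, Disjoint w y) :
    RelSphere StrictComparable n ((· ∪ y) '' s) :=
  h.image (injOn_union_right hd) (strictComparable_union_iff hd)

/-- The proper subsets of `x` on which `f` takes all the values it takes on `x`. -/
def properCovers {κ : Type} (f : V → κ) (x : Finset V) : Set (Finset V) :=
  {y | y ⊂ x ∧ f '' y = f '' x}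

theorem finite_properCovers {κ : Type} (f : V → κ) (x : Finset V) : (properCovers f x).Finite :=
  x.powerset.finite_toSet.subset fun _ hy => Finset.mem_coe.2 (Finset.mem_powerset.2 hy.1.subset)

theorem mem_properCovers_const {x y : Finset V} (hx : x.Nonempty) :
    y ∈ properCovers (fun _ => (0 : ℕ)) x ↔ y ⊂ x ∧ y.Nonempty := by
  refine and_congr_right fun _ => ?_
  rw [Set.Nonempty.image_const (Finset.coe_nonempty.2 hx)]
  constructor
  · intro h
    rw [← Finset.coe_nonempty, ← Set.image_nonempty, h]
    exact Set.singleton_nonempty 0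
  · exact fun h => Set.Nonempty.image_const (Finset.coe_nonempty.2 h) 0

theorem contractible_properCovers_diff {κ : Type} (f : V → κ) {x : Finset V} {a b : V}
    (ha : a ∈ x) (hb : b ∈ x) (hab : a ≠ b) (hf : f a = f b) :
    RelContractible StrictComparable (properCovers f x \ {x.erase a}) := by
  have himg : ∀ z : Finset V, a ∈ z → f '' (z.erase b : Finset V) = f '' z := by
    intro z haz
    refine (Set.image_mono (by simp)).antisymm ?_
    rintro _ ⟨w, hw, rfl⟩
    by_cases hwb : w = b
    · exact ⟨a, by simp [hab, haz], by rw [hf, hwb]⟩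
    · exact ⟨w, by simpa [hwb] using hw, rfl⟩
  have hfin : (properCovers f x \ {x.erase a}).Finite :=
    (finite_properCovers f x).subset Set.sdiff_subset
  refine .of_up hfin (t := {z ∈ properCovers f x \ {x.erase a} | a ∈ z}) (Set.sep_subset _ _) ?_ ?_
  · rintro z ⟨⟨hzx, hzf⟩, hze⟩ hz
    have haz : a ∉ z := fun h => hz ⟨⟨⟨hzx, hzf⟩, hze⟩, h⟩
    have hsub : insert a z ⊆ x := Finset.insert_subset ha hzx.subset
    refine ⟨insert a z, ⟨⟨⟨hsub.ssubset_of_ne ?_, ?_⟩, ?_⟩, by simp⟩,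
      Finset.ssubset_insert haz, ?_⟩
    · rintro rfl
      exact hze (by simp [haz])
    · refine (Set.image_mono hsub).antisymm ?_
      rw [← hzf]
      exact Set.image_mono (by simp)
    · intro e
      have : a ∈ x.erase a := e ▸ Finset.mem_insert_self a z
      simp at this
    · rintro w ⟨-, haw⟩ hzw
      exact Finset.insert_subset haw hzw.subset
  · have hxb : x.erase b ∈ properCovers f x \ {x.erase a} := by
      refine ⟨⟨Finset.erase_ssubset hb, himg x ha⟩, fun e => ?_⟩
      have : a ∈ x.erase a := e ▸ Finset.mem_erase.2 ⟨hab, ha⟩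
      simp at this
    refine .of_down (hfin.subset (Set.sep_subset _ _))
      (t := {z ∈ properCovers f x \ {x.erase a} | a ∈ z ∧ b ∉ z})
      (fun z hz => ⟨hz.1, hz.2.1⟩) ?_ ?_
    · rintro z ⟨⟨⟨hzx, hzf⟩, hze⟩, haz⟩ hz
      have hbz : b ∈ z := by
        by_contra h
        exact hz ⟨⟨⟨hzx, hzf⟩, hze⟩, haz, h⟩
      have haz' : a ∈ z.erase b := Finset.mem_erase.2 ⟨hab, haz⟩
      refine ⟨z.erase b, ⟨⟨⟨(Finset.erase_subset _ _).trans_ssubset hzx,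
        (himg z haz).trans hzf⟩, fun e => ?_⟩, haz', by simp⟩, Finset.erase_ssubset hbz, ?_⟩
      · have : a ∈ x.erase a := e ▸ haz'
        simp at this
      · rintro w ⟨-, -, hbw⟩ hwz
        exact Finset.subset_erase.2 ⟨hwz.subset, hbw⟩
    · refine .of_apex not_strictComparable_self (v := x.erase b)
        (hfin.subset (Set.sep_subset _ _)) ⟨hxb, Finset.mem_erase.2 ⟨hab, ha⟩, by simp⟩ ?_
      rintro w ⟨⟨⟨hwx, -⟩, -⟩, -, hbw⟩
      rcases (Finset.subset_erase.2 ⟨hwx.subset, hbw⟩).eq_or_ssubset with e | e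
      · exact .inl e
      · exact .inr (.inl e)

/-- The proper subsets of `x` meeting all classes of a partition into `k` parts form a sphere
(the boundary of a product of `k` simplices). -/
theorem relSphere_properCovers (f : V → ℕ) (x : Finset V) (m : ℕ)
    (hm : m + (f '' x).ncard = x.card) : RelSphere StrictComparable m (properCovers f x) := by
  induction hk : x.card using Nat.strong_induction_on generalizing f x m with
  | _ k ih =>
    obtain _ | m := m
    · have hinj : Set.InjOn f x := by
        apply Set.injOn_of_ncard_image_eq _ x.finite_toSet
        rw [Set.ncard_coe_finset]; omega
      simp only [RelSphere]
      rw [Set.eq_empty_iff_forall_notMem]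
      rintro y ⟨hy, hyf⟩
      obtain ⟨a, hax, hay⟩ := Finset.exists_of_ssubset hy
      obtain ⟨b, hb, hab⟩ : f a ∈ f '' y := hyf ▸ ⟨a, hax, rfl⟩
      exact hay (hinj (hy.subset hb) hax hab ▸ hb)
    · refine ⟨?_, ?_⟩
      · rintro y ⟨hyx, hyf⟩
        have hcard : (x \ y).card = x.card - y.card := Finset.card_sdiff_of_subset hyx.subset
        have hlt := Finset.card_lt_card hyx
        have hle : (f '' y).ncard ≤ y.card := by
          rw [← Set.ncard_coe_finset y]; exact Set.ncard_image_le y.finite_toSet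
        have hyne : 0 < y.card := by
          rw [Finset.card_pos, ← Finset.coe_nonempty, ← Set.image_nonempty (f := f), hyf]
          exact (Finset.coe_nonempty.2 (Finset.card_pos.1 (by omega))).image f
        have hne : (x \ y).Nonempty := Finset.card_pos.1 (by omega)
        have h1 : RelSphere StrictComparable (y.card - (f '' y).ncard)
            {w ∈ properCovers f x | w ⊂ y} := by
          have h3 := ih y.card (by omega) f y (y.card - (f '' y).ncard) (by omega) rfl
          convert h3 using 1
          ext w
          constructor
          · rintro ⟨⟨-, hw⟩, h⟩
            exact ⟨h, hw.trans hyf.symm⟩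
          · rintro ⟨h, hw⟩
            exact ⟨⟨h.trans hyx, hw.trans hyf⟩, h⟩
        have h2 : RelSphere StrictComparable ((x \ y).card - 1)
            {w ∈ properCovers f x | y ⊂ w} := by
          have h3 := ih (x \ y).card (by omega) (fun _ => 0) (x \ y) ((x \ y).card - 1)
            (by
              rw [Set.Nonempty.image_const (Finset.coe_nonempty.2 hne), Set.ncard_singleton]
              omega) rfl
          have hd : ∀ w ∈ properCovers (fun _ => (0 : ℕ)) (x \ y), Disjoint w y := fun w hw =>
            Finset.sdiff_disjoint.mono_left hw.1.subset
          convert h3.image_union hd using 1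
          ext w
          simp only [Set.mem_image, mem_properCovers_const hne]
          constructor
          · rintro ⟨⟨hwx, -⟩, hyw⟩
            refine ⟨w \ y, ⟨?_, ?_⟩, Finset.sdiff_union_of_subset hyw.subset⟩
            · refine (Finset.sdiff_subset_sdiff hwx.subset subset_rfl).ssubset_of_ne fun e => ?_
              apply hwx.ne
              rw [← Finset.sdiff_union_of_subset hyw.subset, e,
                Finset.sdiff_union_of_subset hyx.subset]
            · exact Finset.sdiff_nonempty.2 hyw.2
          · rintro ⟨z, ⟨hz, hzn⟩, rfl⟩
            have hsub : z ∪ y ⊆ x :=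
              Finset.union_subset (hz.subset.trans Finset.sdiff_subset) hyx.subset
            refine ⟨⟨hsub.ssubset_of_ne fun e => ?_, ?_⟩, ?_⟩
            · apply hz.2
              rw [← e, Finset.union_sdiff_right]
              exact Finset.sdiff_subset
            · refine (Set.image_mono hsub).antisymm ?_
              rw [← hyf]
              exact Set.image_mono (by simp)
            · refine Finset.subset_union_right.ssubset_of_ne fun e => ?_
              obtain ⟨a, ha⟩ := hzn
              exact (Finset.mem_sdiff.1 (hz.subset ha)).2 (e ▸ Finset.mem_union_left _ ha)
        have := RelSphere.of_below_above (finite_properCovers f x) h1 h2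
        convert this using 1
        rw [hyf] at hle ⊢
        omega
      · have hninj : ¬ Set.InjOn f x := fun h => by
          have := h.ncard_image
          rw [Set.ncard_coe_finset] at this
          omega
        simp only [Set.InjOn, not_forall] at hninj
        obtain ⟨a, ha, b, hb, hf, hab⟩ := hninj
        refine ⟨x.erase a, ⟨Finset.erase_ssubset ha, ?_⟩,
          contractible_properCovers_diff f ha hb hab hf⟩
        refine (Set.image_mono (by simp)).antisymm ?_
        rintro _ ⟨w, hw, rfl⟩
        by_cases hwa : w = a
        · exact ⟨b, by simpa [Ne.symm hab] using hb, by rw [hwa, hf]⟩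
        · exact ⟨w, by simpa [hwa] using hw, rfl⟩

/-- The nonempty cliques of `r` contained in `s`. -/
def cliques (r : V → V → Prop) (s : Set V) : Set (Finset V) :=
  {x | x.Nonempty ∧ ↑x ⊆ s ∧ ∀ a ∈ x, ∀ b ∈ x, a ≠ b → r a b}

variable {r : V → V → Prop} {s : Set V}

theorem finite_cliques (hs : s.Finite) : (cliques r s).Finite :=
  hs.toFinset.powerset.finite_toSet.subset fun x hx => by
    have := hx.2.1
    simpa [← Finset.coe_subset] using this

theorem disjoint_of_mem_cliques_link (hi : ∀ a, ¬ r a a) {x : Finset V} :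
    ∀ w ∈ cliques r {w ∈ s | ∀ a ∈ x, r a w}, Disjoint w x := fun _ hw =>
  Finset.disjoint_left.2 fun a ha hax => hi a ((hw.2.1 ha).2 a hax)

theorem cliques_above (hi : ∀ a, ¬ r a a) (hr : ∀ a b, r a b → r b a) {x : Finset V}
    (hx : x ∈ cliques r s) :
    {z ∈ cliques r s | x ⊂ z} = (· ∪ x) '' cliques r {w ∈ s | ∀ a ∈ x, r a w} := by
  ext z
  constructor
  · rintro ⟨⟨-, hzs, hzc⟩, hxz⟩
    refine ⟨z \ x, ⟨Finset.sdiff_nonempty.2 hxz.2, fun u hu => ?_, fun a ha b hb => ?_⟩,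
      Finset.sdiff_union_of_subset hxz.subset⟩
    · have hu' := Finset.mem_sdiff.1 (Finset.mem_coe.1 hu)
      exact ⟨hzs hu'.1, fun a ha => hzc a (hxz.subset ha) u hu'.1
        (by rintro rfl; exact hu'.2 ha)⟩
    · exact hzc a (Finset.mem_sdiff.1 ha).1 b (Finset.mem_sdiff.1 hb).1
  · rintro ⟨w, hw, rfl⟩
    have hd := disjoint_of_mem_cliques_link hi w hw
    obtain ⟨hwn, hws, hwc⟩ := hw
    refine ⟨⟨hwn.mono Finset.subset_union_left, ?_, ?_⟩, ?_⟩
    · rw [Finset.coe_union]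
      exact Set.union_subset (fun u hu => (hws hu).1) hx.2.1
    · intro a ha b hb hab
      rcases Finset.mem_union.1 ha with ha | ha <;> rcases Finset.mem_union.1 hb with hb | hb
      · exact hwc a ha b hb hab
      · exact hr _ _ ((hws ha).2 b hb)
      · exact (hws hb).2 a ha
      · exact hx.2.2 a ha b hb hab
    · refine Finset.subset_union_right.ssubset_of_ne fun e => ?_
      obtain ⟨a, ha⟩ := hwn
      exact Finset.disjoint_left.1 hd ha (e ▸ Finset.mem_union_left _ ha)

theorem singleton_mem_cliques {v : V} (hv : v ∈ s) : {v} ∈ cliques r s :=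
  ⟨Finset.singleton_nonempty v, by simpa using hv, fun a ha b hb hab =>
    absurd ((Finset.mem_singleton.1 ha).trans (Finset.mem_singleton.1 hb).symm) hab⟩

theorem RelContractible.cliques_diff_singleton {v : V} (hs : s.Finite)
    (h : RelContractible StrictComparable (cliques r (s \ {v}))) :
    RelContractible StrictComparable (cliques r s \ {{v}}) := by
  refine h.of_down ((finite_cliques hs).subset Set.sdiff_subset) ?_ ?_
  · rintro z ⟨hzn, hzs, hzc⟩
    refine ⟨⟨hzn, hzs.trans Set.sdiff_subset, hzc⟩, ?_⟩
    rintro rfl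
    exact (hzs (Finset.mem_coe.2 (Finset.mem_singleton_self v))).2 rfl
  · rintro z ⟨⟨hzn, hzs, hzc⟩, hzv⟩ hz
    have hvz : v ∈ z := by
      by_contra hvz
      exact hz ⟨hzn, fun a ha => ⟨hzs ha, by rintro rfl; exact hvz ha⟩, hzc⟩
    refine ⟨z.erase v, ⟨?_, ?_, ?_⟩, Finset.erase_ssubset hvz, ?_⟩
    · rw [Finset.nonempty_iff_ne_empty, Ne, Finset.erase_eq_empty_iff]
      rintro (rfl | rfl)
      · simp at hvz
      · exact hzv rfl
    · rw [Finset.coe_erase]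
      exact Set.sdiff_subset_sdiff_left hzs
    · exact fun a ha b hb => hzc a (Finset.mem_of_mem_erase ha) b (Finset.mem_of_mem_erase hb)
    · rintro w ⟨-, hws, -⟩ hwz
      exact Finset.subset_erase.2 ⟨hwz.subset, fun hvw => (hws hvw).2 rfl⟩

theorem RelContractible.cliques (hi : ∀ a, ¬ r a a) (hr : ∀ a b, r a b → r b a) (hs : s.Finite)
    (h : RelContractible r s) : RelContractible StrictComparable (cliques r s) := by
  induction h with
  | single v =>
    convert RelContractible.single {v} using 1
    ext x
    constructor
    · rintro ⟨hx, hxv, -⟩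
      rw [Finset.coe_subset_singleton] at hxv
      exact (Finset.subset_singleton_iff.1 hxv).resolve_left hx.ne_empty
    · rintro rfl
      exact singleton_mem_cliques rfl
  | step s v hv h1 h2 ih1 ih2 =>
    refine .step _ {v} (singleton_mem_cliques hv) ?_
      ((ih2 (hs.subset Set.sdiff_subset)).cliques_diff_singleton hs)
    have hl := cliques_above hi hr (singleton_mem_cliques (r := r) hv)
    have hd := disjoint_of_mem_cliques_link (s := s) hi (x := {v})
    simp only [Finset.mem_singleton, forall_eq] at hl hd
    convert (ih1 (hs.subset (Set.sep_subset _ _))).image_union hd using 1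
    rw [← hl]
    ext w
    refine and_congr_right fun hw => or_iff_left fun h => ?_
    exact hw.1.ne_empty (Finset.ssubset_singleton_iff.1 h)

theorem RelSphere.cliques_above (hi : ∀ a, ¬ r a a) (hr : ∀ a b, r a b → r b a) {x : Finset V}
    (hx : x ∈ cliques r s) {n : ℕ}
    (h : RelSphere StrictComparable n (cliques r {w ∈ s | ∀ a ∈ x, r a w})) :
    RelSphere StrictComparable n {z ∈ cliques r s | x ⊂ z} :=
  _root_.cliques_above hi hr hx ▸ h.image_union (disjoint_of_mem_cliques_link hi)

/-- The link of a clique in a manifold is a sphere. -/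
theorem RelSphere.link_of_manifold {n : ℕ} (h : ∀ v ∈ s, RelSphere r n {w ∈ s | r v w})
    {x : Finset V} (hx : x ∈ _root_.cliques r s) :
    ∃ m, m + x.card = n + 1 ∧ RelSphere r m {w ∈ s | ∀ a ∈ x, r a w} := by
  obtain ⟨⟨v, hv⟩, hxs, hxc⟩ := hx
  obtain ⟨m, hm, hl⟩ := (h v (hxs hv)).link (x.erase v)
    (fun a ha => by
      have ha := Finset.mem_erase.1 (Finset.mem_coe.1 ha)
      exact ⟨hxs ha.2, hxc v hv a ha.2 ha.1.symm⟩)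
    (fun a ha b hb => hxc a (Finset.mem_of_mem_erase ha) b (Finset.mem_of_mem_erase hb))
  refine ⟨m, by rw [← Finset.card_erase_add_one hv]; omega, ?_⟩
  convert hl using 1
  ext w
  simp only [Set.mem_ofPred_eq, and_assoc, and_congr_right_iff]
  refine fun _ => ⟨fun h => ⟨h v hv, fun a ha => h a (Finset.mem_of_mem_erase ha)⟩, ?_⟩
  rintro ⟨h1, h2⟩ a ha
  by_cases hav : a = v
  · exact hav ▸ h1
  · exact h2 a (Finset.mem_erase.2 ⟨hav, ha⟩)

/-- The Barycentric refinement of a sphere is a sphere. -/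
theorem RelSphere.cliques (hi : ∀ a, ¬ r a a) (hr : ∀ a b, r a b → r b a) (hs : s.Finite) {n : ℕ}
    (h : RelSphere r n s) : RelSphere StrictComparable n (cliques r s) := by
  induction n using Nat.strong_induction_on generalizing s with
  | _ n ih =>
    obtain _ | n := n
    · simp only [RelSphere] at h ⊢
      subst h
      rw [Set.eq_empty_iff_forall_notMem]
      rintro x ⟨⟨a, ha⟩, hx, -⟩
      exact hx ha
    obtain ⟨h1, v, hv, h2⟩ := h
    refine ⟨fun x hx => ?_, {v}, singleton_mem_cliques hv,
      (h2.cliques hi hr (hs.subset Set.sdiff_subset)).cliques_diff_singleton hs⟩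
    obtain ⟨m, hm, hl⟩ := RelSphere.link_of_manifold h1 hx
    have hpos := hx.1.card_pos
    have hup := (ih m (by omega) (hs.subset (Set.sep_subset _ _)) hl).cliques_above hi hr hx
    have hlow := relSphere_properCovers (fun _ => 0) x (x.card - 1) (by
      rw [Set.Nonempty.image_const (Finset.coe_nonempty.2 hx.1), Set.ncard_singleton]
      omega)
    have heq : properCovers (fun _ => 0) x = {w ∈ _root_.cliques r s | w ⊂ x} := by
      ext w
      rw [mem_properCovers_const hx.1]
      constructor
      · rintro ⟨hwx, hw⟩
        exact ⟨⟨hw, (Finset.coe_subset.2 hwx.subset).trans hx.2.1,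
          fun a ha b hb => hx.2.2 a (hwx.subset ha) b (hwx.subset hb)⟩, hwx⟩
      · exact fun hw => ⟨hw.2, hw.1.1⟩
    convert RelSphere.of_below_above (finite_cliques hs) (heq ▸ hlow) hup using 1
    omega

/-- In the Barycentric refinement of a manifold, the cliques on which `f` takes all the values in
`u` induce a subgraph whose unit spheres are spheres. -/
theorem relSphere_cliques_image_eq (hi : ∀ a, ¬ r a a) (hr : ∀ a b, r a b → r b a) (hs : s.Finite)
    {n : ℕ} (h : ∀ v ∈ s, RelSphere r n {w ∈ s | r v w}) (f : V → ℕ) {u : Set ℕ}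
    (hu : ∀ v, f v ∈ u) {x : Finset V} (hx : x ∈ cliques r s) (hfx : f '' x = u) :
    ∃ k, k + u.ncard = n + 1 ∧
      RelSphere StrictComparable k {w ∈ {w ∈ cliques r s | f '' w = u} | StrictComparable x w} := by
  have hle : (f '' x).ncard ≤ x.card := by
    rw [← Set.ncard_coe_finset x]; exact Set.ncard_image_le x.finite_toSet
  obtain ⟨m, hm, hl⟩ := RelSphere.link_of_manifold h hx
  have hup := (hl.cliques hi hr (hs.subset (Set.sep_subset _ _))).cliques_above hi hr hx
  have hlow := relSphere_properCovers f x (x.card - (f '' x).ncard) (by omega)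
  have hup' : {w ∈ cliques r s | x ⊂ w} = {w ∈ {w ∈ cliques r s | f '' w = u} | x ⊂ w} := by
    ext w
    refine ⟨fun hw => ⟨⟨hw.1, ?_⟩, hw.2⟩, fun hw => ⟨hw.1.1, hw.2⟩⟩
    refine Set.Subset.antisymm (Set.image_subset_iff.2 fun v _ => hu v) ?_
    rw [← hfx]
    exact Set.image_mono (Finset.coe_subset.2 hw.2.subset)
  have hlow' : properCovers f x = {w ∈ {w ∈ cliques r s | f '' w = u} | w ⊂ x} := by
    ext w
    constructor
    · rintro ⟨hwx, hw⟩
      refine ⟨⟨⟨?_, (Finset.coe_subset.2 hwx.subset).trans hx.2.1,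
        fun a ha b hb => hx.2.2 a (hwx.subset ha) b (hwx.subset hb)⟩, hw.trans hfx⟩, hwx⟩
      rw [← Finset.coe_nonempty, ← Set.image_nonempty (f := f), hw]
      exact (Finset.coe_nonempty.2 hx.1).image f
    · exact fun hw => ⟨hw.2, hw.1.2.trans hfx.symm⟩
  refine ⟨x.card - (f '' x).ncard + m, by rw [← hfx]; omega, ?_⟩
  exact RelSphere.of_below_above ((finite_cliques hs).subset (Set.sep_subset _ _))
    (hlow' ▸ hlow) (hup' ▸ hup)

end Inclusion

namespace FGraph

variable {V : Type}

theorem coe_verts_unitSphere (G : FGraph V) (v : V) :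
    (↑(G.unitSphere v).verts : Set V) = {w ∈ (G.verts : Set V) | G.Adj v w} := by
  simp [unitSphere, induce]

theorem coe_verts_erase (G : FGraph V) (v : V) :
    (↑(G.erase v).verts : Set V) = (G.verts : Set V) \ {v} := by
  ext w
  simp [erase, induce]

/-- `G` has the adjacency `r` on its vertices. -/
def Agrees (G : FGraph V) (r : V → V → Prop) : Prop :=
  ∀ a ∈ G.verts, ∀ b ∈ G.verts, G.Adj a b ↔ r a b

theorem Agrees.induce {G : FGraph V} {r : V → V → Prop} (h : G.Agrees r) (P : V → Prop) :
    (G.induce P).Agrees r := by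
  intro a ha b hb
  simp only [FGraph.induce, Finset.mem_filter] at ha hb ⊢
  rw [← h a ha.1 b hb.1]
  tauto

theorem Agrees.unitSphere {G : FGraph V} {r : V → V → Prop} (h : G.Agrees r) (v : V) :
    (G.unitSphere v).Agrees r :=
  h.induce _

theorem Agrees.coe_verts_unitSphere {G : FGraph V} {r : V → V → Prop} (h : G.Agrees r) {v : V}
    (hv : v ∈ G.verts) :
    (↑(G.unitSphere v).verts : Set V) = {w ∈ (G.verts : Set V) | r v w} := by
  rw [FGraph.coe_verts_unitSphere]
  ext w
  exact and_congr_right fun hw => h v hv w hw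

theorem Contractible.relContractible {G : FGraph V} (h : Contractible G) {r : V → V → Prop}
    (hr : G.Agrees r) : RelContractible r (G.verts : Set V) := by
  induction h with
  | single G v h => rw [h, Finset.coe_singleton]; exact .single v
  | step G v hv h1 h2 ih1 ih2 =>
    refine .step _ v hv ?_ ?_
    · rw [← hr.coe_verts_unitSphere hv]
      exact ih1 (hr.induce _)
    · rw [← coe_verts_erase]
      exact ih2 (hr.induce _)

theorem _root_.RelContractible.contractible {r : V → V → Prop} {s : Set V}
    (h : RelContractible r s) {G : FGraph V} (hs : (G.verts : Set V) = s) (hr : G.Agrees r) :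
    Contractible G := by
  induction h generalizing G with
  | single v => exact .single G v (by simpa using hs)
  | step s v hv h1 h2 ih1 ih2 =>
    subst hs
    exact .step G v hv (ih1 (hr.coe_verts_unitSphere hv) (hr.induce _))
      (ih2 (coe_verts_erase G v) (hr.induce _))

theorem isSphere_iff {d : ℤ} {G : FGraph V} : IsSphere d G ↔
    (d = -1 ∧ G.verts = ∅) ∨ (0 ≤ d ∧ (∀ v ∈ G.verts, IsSphere (d - 1) (G.unitSphere v)) ∧
      ∃ v ∈ G.verts, Contractible (G.erase v)) := by
  constructor
  · rintro (⟨_, h⟩ | ⟨_, _, ⟨_, hd, _, h⟩, v, hv, hc⟩)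
    · exact .inl ⟨rfl, h⟩
    · exact .inr ⟨hd, h, v, hv, hc⟩
  · rintro (⟨rfl, h⟩ | ⟨hd, h, v, hv, hc⟩)
    · exact .empty G h
    · exact .punctured d G (.intro d hd G h) v hv hc

theorem isSphere_iff_relSphere {n : ℕ} {G : FGraph V} {r : V → V → Prop} (hr : G.Agrees r) :
    IsSphere ((n : ℤ) - 1) G ↔ RelSphere r n (G.verts : Set V) := by
  induction n generalizing G with
  | zero => rw [isSphere_iff]; simp [RelSphere]
  | succ n ih =>
    rw [isSphere_iff, RelSphere, or_iff_right (by omega), and_iff_right (by omega),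
      Nat.cast_succ, add_sub_cancel_right]
    refine and_congr (forall₂_congr fun v hv => ?_)
      (exists_congr fun v => and_congr_right fun _ => ?_)
    · rw [ih (hr.unitSphere v), hr.coe_verts_unitSphere hv]
    · exact ⟨fun h => coe_verts_erase G v ▸ h.relContractible (hr.induce _),
        fun h => h.contractible (coe_verts_erase G v) (hr.induce _)⟩

theorem coe_verts_barycentric (G : FGraph V) :
    (↑G.barycentric.verts : Set (Finset V)) = cliques G.Adj G.verts := by
  ext x
  simp only [barycentric, Finset.coe_filter, Finset.mem_powerset]
  exact ⟨fun h => h.2, fun h => ⟨Finset.coe_subset.1 h.2.1, h⟩⟩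

theorem agrees_barycentric (G : FGraph V) : G.barycentric.Agrees StrictComparable := by
  intro x hx y hy
  simp only [barycentric, Finset.mem_filter] at hx hy ⊢
  simp [StrictComparable, hx.2, hy.2]

end FGraph

/-- The class of a sign value: `-1+i`, `1-i`, or any other. -/
noncomputable def signClass (z : ℂ) : ℕ :=
  if z = -1 + Complex.I then 0 else if z = 1 - Complex.I then 1 else 2

theorem three_le_card_and_mem_iff (s : Finset ℂ) :
    (3 ≤ s.card ∧ -1 + Complex.I ∈ s ∧ 1 - Complex.I ∈ s) ↔
      signClass '' (s : Set ℂ) = {0, 1, 2} := by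
  have hne : -1 + Complex.I ≠ 1 - Complex.I := fun h => by
    have := congrArg Complex.re h
    norm_num at this
  have h0 : ∀ z, signClass z = 0 ↔ z = -1 + Complex.I := fun z => by
    unfold signClass; split_ifs <;> simp_all
  have h1 : ∀ z, signClass z = 1 ↔ z = 1 - Complex.I := fun z => by
    unfold signClass; split_ifs <;> simp_all
  have hlt : ∀ z, signClass z = 0 ∨ signClass z = 1 ∨ signClass z = 2 := fun z => by
    unfold signClass; split_ifs <;> simp
  have himg : signClass '' (s : Set ℂ) ⊆ {0, 1, 2} := by
    rintro _ ⟨z, -, rfl⟩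
    exact hlt z
  constructor
  · rintro ⟨hc, ha, hb⟩
    obtain ⟨z, hz, hz'⟩ : ∃ z ∈ s, z ∉ ({-1 + Complex.I, 1 - Complex.I} : Finset ℂ) := by
      by_contra! hcon
      have := (Finset.card_le_card (show s ⊆ {-1 + Complex.I, 1 - Complex.I} from hcon)).trans
        Finset.card_le_two
      omega
    simp only [Finset.mem_insert, Finset.mem_singleton, ← h0, ← h1] at hz'
    refine himg.antisymm ?_
    rintro _ (rfl | rfl | rfl)
    · exact ⟨_, ha, (h0 _).2 rfl⟩
    · exact ⟨_, hb, (h1 _).2 rfl⟩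
    · exact ⟨z, hz, by have := hlt z; tauto⟩
  · intro h
    obtain ⟨a, ha, ha'⟩ : 0 ∈ signClass '' (s : Set ℂ) := h ▸ by simp
    obtain ⟨b, hb, hb'⟩ : 1 ∈ signClass '' (s : Set ℂ) := h ▸ by simp
    refine ⟨?_, (h0 a).1 ha' ▸ ha, (h1 b).1 hb' ▸ hb⟩
    rw [← Set.ncard_coe_finset s]
    have : Set.ncard ({0, 1, 2} : Set ℕ) = 3 := Set.ncard_eq_three.2 ⟨0, 1, 2, by simp⟩
    rw [← this, ← h]
    exact Set.ncard_image_le s.finite_toSet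

namespace FGraph

variable {V : Type}

theorem coe_verts_complexLevelSet (G : FGraph V) (ψ : V → ℂ) (c : ℂ) :
    (↑(G.complexLevelSet ψ c).verts : Set (Finset V)) =
      {x ∈ cliques G.Adj G.verts |
        (fun v => signClass (csgn (ψ v - c))) '' (x : Set V) = {0, 1, 2}} := by
  rw [← coe_verts_barycentric]
  ext x
  simp only [complexLevelSet, induce, Finset.coe_filter, three_le_card_and_mem_iff, signValues,
    Finset.coe_image, Set.image_image]
  rfl

end FGraph

/-- Morse–Sard for complex functions. If `G` is a `d`-manifold and
`ψ : V → ℂ`, `c : ℂ` are such that `Re(ψ - c)` and `Im(ψ - c)` are nowhere zero on `V`,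
then the level set `{ψ = c}` is either the empty graph or a `(d-2)`-manifold. -/
theorem morse_sard_complex {V : Type} (G : FGraph V) (d : ℤ)
    (hG : FGraph.IsManifold d G) (ψ : V → ℂ) (c : ℂ)
    (hψ : ∀ v ∈ G.verts, (ψ v - c).re ≠ 0 ∧ (ψ v - c).im ≠ 0) :
    (G.complexLevelSet ψ c).verts = ∅ ∨
      FGraph.IsManifold (d - 2) (G.complexLevelSet ψ c) := by
  rw [or_iff_not_imp_left, ← Ne, ← Finset.nonempty_iff_ne_empty]
  rintro hne
  obtain ⟨_, hd, _, hS⟩ := hG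
  lift d to ℕ using hd
  have hsph : ∀ v ∈ (G.verts : Set V), RelSphere G.Adj d {w ∈ (G.verts : Set V) | G.Adj v w} := by
    intro v hv
    have hr : G.Agrees G.Adj := fun _ _ _ _ => Iff.rfl
    rw [← hr.coe_verts_unitSphere hv, ← FGraph.isSphere_iff_relSphere (hr.unitSphere v)]
    exact hS v hv
  have hr := (G.agrees_barycentric).induce (fun x =>
    3 ≤ (FGraph.signValues ψ c x).card ∧
    (-1 + Complex.I) ∈ FGraph.signValues ψ c x ∧ (1 - Complex.I) ∈ FGraph.signValues ψ c x)
  have hcard : Set.ncard ({0, 1, 2} : Set ℕ) = 3 := Set.ncard_eq_three.2 ⟨0, 1, 2, by simp⟩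
  have key : ∀ x ∈ (G.complexLevelSet ψ c).verts, ∃ k : ℕ, k + 3 = d + 1 ∧
      FGraph.IsSphere ((k : ℤ) - 1) ((G.complexLevelSet ψ c).unitSphere x) := by
    intro x hx
    have hx' := Finset.mem_coe.2 hx
    rw [FGraph.coe_verts_complexLevelSet] at hx'
    obtain ⟨k, hk, hsk⟩ := relSphere_cliques_image_eq G.loopless (fun _ _ => G.symm)
      G.verts.finite_toSet hsph (fun v => signClass (csgn (ψ v - c))) (u := {0, 1, 2})
      (fun v => by unfold signClass; split_ifs <;> simp) hx'.1 hx'.2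
    refine ⟨k, hcard ▸ hk, (FGraph.isSphere_iff_relSphere (hr.unitSphere x)).2 ?_⟩
    rw [← FGraph.coe_verts_complexLevelSet] at hsk
    exact hr.coe_verts_unitSphere hx ▸ hsk
  obtain ⟨x, hx⟩ := hne
  obtain ⟨k, hk, -⟩ := key x hx
  refine .intro _ (by omega) _ fun y hy => ?_
  obtain ⟨k, hk, h⟩ := key y hy
  convert h using 1
  omega
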